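/- Let V be a monoidal category with projections which is cartesian closed and whose monoidal structure (V, ⊗, I) is biclosed. Let V_cart denote the (V, ×)-enriched category given by the self-enrichment of V via the cartesian internal hom, regarded as a (V, ⊗)-enriched category by transport along the lax monoidal identity functor (V, ×) → (V, ⊗). Then the identity on objects together with the canonical morphisms can_r : Hom(X, Y) → Homᵣ(X, Y) defines a (V, ⊗)-enriched functor V_cart → V_r; that is, the morphisms can_r are compatible with the enriched identities and the enriched compositions. Dually, the identity on objects together with the canonical morphisms can_l : Hom(X, Y) → Homₗ(X, Y) defines a V̄-enriched functor from V_cart (regarded as a V̄-category by transport along the lax monoidal identity (V, ×) → (V, ⊗̄)) to V_l. -/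

import Mathlib

universe v u w w'

open CategoryTheory MonoidalCategory Limits

noncomputable section

namespace PaperComma

variable {V : Type u} [Category.{v} V] [MonoidalCategory V]

/-- A *right closed* structure on a monoidal category `V`: for every object `Y`, the
functor `- ⊗ Y` admits a right adjoint `Homᵣ(Y, -)`. -/
structure RightClosed (V : Type u) [Category.{v} V] [MonoidalCategory V] where
  homr : V → V ⥤ V
  adj : ∀ Y : V, tensorRight Y ⊣ homr Y

/-- A *left closed* structure on a monoidal category `V`: for every object `X`, the
functor `X ⊗ -` admits a right adjoint `Homₗ(X, -)`. -/
structure LeftClosed (V : Type u) [Category.{v} V] [MonoidalCategory V] where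
  homl : V → V ⥤ V
  adj : ∀ X : V, tensorLeft X ⊣ homl X

namespace RightClosed

variable (R : RightClosed V)

/-- `Homᵣ(Y, Z)`. -/
def hr (Y Z : V) : V := (R.homr Y).obj Z

/-- Transposition under the adjunction `- ⊗ Y ⊣ Homᵣ(Y, -)`. -/
def curry {X Y Z : V} (f : X ⊗ Y ⟶ Z) : X ⟶ R.hr Y Z :=
  ((R.adj Y).homEquiv X Z) f

/-- Inverse transposition. -/
def uncurry {X Y Z : V} (g : X ⟶ R.hr Y Z) : X ⊗ Y ⟶ Z :=
  ((R.adj Y).homEquiv X Z).symm g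

/-- The evaluation morphism (counit) `Homᵣ(Y, Z) ⊗ Y ⟶ Z`. -/
def ev (Y Z : V) : R.hr Y Z ⊗ Y ⟶ Z :=
  (R.adj Y).counit.app Z

/-- The identity `I ⟶ Homᵣ(X, X)` of the `V`-category `V_r`. -/
def idr (X : V) : 𝟙_ V ⟶ R.hr X X :=
  R.curry (λ_ X).hom

/-- The composition `Homᵣ(Y, Z) ⊗ Homᵣ(X, Y) ⟶ Homᵣ(X, Z)` of the `V`-category `V_r`. -/
def compr (X Y Z : V) : R.hr Y Z ⊗ R.hr X Y ⟶ R.hr X Z :=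
  R.curry ((α_ (R.hr Y Z) (R.hr X Y) X).hom ≫ (R.hr Y Z ◁ R.ev X Y) ≫ R.ev Y Z)

/-- Contravariant action of `Homᵣ` in its first variable. -/
def pre {Y' Y : V} (f : Y' ⟶ Y) (Z : V) : R.hr Y Z ⟶ R.hr Y' Z :=
  R.curry ((R.hr Y Z ◁ f) ≫ R.ev Y Z)

end RightClosed

namespace LeftClosed

variable (L : LeftClosed V)

/-- `Homₗ(X, Z)`. -/
def hl (X Z : V) : V := (L.homl X).obj Z

/-- Transposition under the adjunction `X ⊗ - ⊣ Homₗ(X, -)`. -/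
def curry {X A B : V} (f : X ⊗ A ⟶ B) : A ⟶ L.hl X B :=
  ((L.adj X).homEquiv A B) f

/-- Inverse transposition. -/
def uncurry {X A B : V} (g : A ⟶ L.hl X B) : X ⊗ A ⟶ B :=
  ((L.adj X).homEquiv A B).symm g

/-- The evaluation morphism (counit) `X ⊗ Homₗ(X, Z) ⟶ Z`. -/
def ev (X Z : V) : X ⊗ L.hl X Z ⟶ Z :=
  (L.adj X).counit.app Z

/-- The identity `I ⟶ Homₗ(X, X)` of the anti `V`-category `V_l`. -/
def idl (X : V) : 𝟙_ V ⟶ L.hl X X :=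
  L.curry (ρ_ X).hom

/-- The composition `Homₗ(X, Y) ⊗ Homₗ(Y, Z) ⟶ Homₗ(X, Z)` of the anti `V`-category `V_l`. -/
def compl (X Y Z : V) : L.hl X Y ⊗ L.hl Y Z ⟶ L.hl X Z :=
  L.curry ((α_ X (L.hl X Y) (L.hl Y Z)).inv ≫ (L.ev X Y ▷ L.hl Y Z) ≫ L.ev Y Z)

/-- Contravariant action of `Homₗ` in its first variable. -/
def pre {X' X : V} (g : X' ⟶ X) (Z : V) : L.hl X Z ⟶ L.hl X' Z :=
  L.curry ((g ▷ L.hl X Z) ≫ L.ev X Z)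

end LeftClosed

section Projections

variable (hI : IsTerminal (𝟙_ V))

/-- The first projection `X ⊗ Y ⟶ X`, when the monoidal unit is terminal. -/
def pi1 (X Y : V) : X ⊗ Y ⟶ X := (X ◁ hI.from Y) ≫ (ρ_ X).hom

/-- The second projection `X ⊗ Y ⟶ Y`, when the monoidal unit is terminal. -/
def pi2 (X Y : V) : X ⊗ Y ⟶ Y := (hI.from X ▷ Y) ≫ (λ_ Y).hom

/-- The canonical morphism `π = (π₁, π₂) : X ⊗ Y ⟶ X ⨯ Y`. -/
def piMap [HasBinaryProducts V] (X Y : V) : X ⊗ Y ⟶ X ⨯ Y :=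
  prod.lift (pi1 hI X Y) (pi2 hI X Y)

end Projections

end PaperComma


namespace PaperComma

variable {V : Type u} [Category.{v} V] [MonoidalCategory V]

/-- A cartesian closed structure on `V`: for every object `X`, the functor `- ⨯ X`
admits a right adjoint `Hom(X, -)` (the cartesian internal hom). -/
structure CartClosed (V : Type u) [Category.{v} V] [HasBinaryProducts V] where
  chom : V → V ⥤ V
  adj : ∀ X : V, prod.functor.flip.obj X ⊣ chom X

namespace CartClosed

variable [HasBinaryProducts V] (cc : CartClosed V)

/-- The cartesian internal hom `Hom(X, Z)`. -/
def ch (X Z : V) : V := (cc.chom X).obj Z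

/-- Transposition under the adjunction `- ⨯ X ⊣ Hom(X, -)`. -/
def curry {W X B : V} (f : W ⨯ X ⟶ B) : W ⟶ cc.ch X B :=
  ((cc.adj X).homEquiv W B) f

/-- Inverse transposition. -/
def uncurry {W X B : V} (g : W ⟶ cc.ch X B) : W ⨯ X ⟶ B :=
  ((cc.adj X).homEquiv W B).symm g

/-- The evaluation morphism `Hom(X, Z) ⨯ X ⟶ Z`. -/
def ev (X Z : V) : cc.ch X Z ⨯ X ⟶ Z := (cc.adj X).counit.app Z

/-- The identity `I ⟶ Hom(X, X)` of the self-enrichment `V_cart` (with the terminal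
unit `I`). -/
def cid (X : V) : 𝟙_ V ⟶ cc.ch X X := cc.curry prod.snd

/-- The composition `Hom(Y, Z) ⨯ Hom(X, Y) ⟶ Hom(X, Z)` of the self-enrichment
`V_cart`. -/
def ccomp (X Y Z : V) : cc.ch Y Z ⨯ cc.ch X Y ⟶ cc.ch X Z :=
  cc.curry ((prod.associator (cc.ch Y Z) (cc.ch X Y) X).hom
    ≫ prod.map (𝟙 (cc.ch Y Z)) (cc.ev X Y) ≫ cc.ev Y Z)

/-- Contravariant action of the cartesian internal hom in its first variable. -/
def cpre {Y' Y : V} (f : Y' ⟶ Y) (Z : V) : cc.ch Y Z ⟶ cc.ch Y' Z :=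
  cc.curry (prod.map (𝟙 (cc.ch Y Z)) f ≫ cc.ev Y Z)

end CartClosed

section Canonical

variable [HasBinaryProducts V] (hI : IsTerminal (𝟙_ V))

/-- The canonical morphism `can_r : Hom(X, Y) ⟶ Homᵣ(X, Y)`, corresponding under the
adjunction `- ⊗ X ⊣ Homᵣ(X, -)` to `Hom(X, Y) ⊗ X --π--> Hom(X, Y) ⨯ X --ev--> Y`. -/
def canr (R : RightClosed V) (cc : CartClosed V) (X Y : V) : cc.ch X Y ⟶ R.hr X Y :=
  R.curry (piMap hI (cc.ch X Y) X ≫ cc.ev X Y)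

/-- The canonical morphism `can_l : Hom(X, Y) ⟶ Homₗ(X, Y)`, corresponding under the
adjunction `X ⊗ - ⊣ Homₗ(X, -)` to
`X ⊗ Hom(X, Y) --π--> X ⨯ Hom(X, Y) ≅ Hom(X, Y) ⨯ X --ev--> Y`. -/
def canl (L : LeftClosed V) (cc : CartClosed V) (X Y : V) : cc.ch X Y ⟶ L.hl X Y :=
  L.curry (piMap hI X (cc.ch X Y) ≫ (prod.braiding X (cc.ch X Y)).hom ≫ cc.ev X Y)

end Canonical

end PaperComma

namespace PaperComma

variable {V : Type u} [Category.{v} V] [MonoidalCategory V]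

namespace RightClosed

variable (R : RightClosed V)

lemma comp_curry {W X Y Z : V} (g : W ⟶ X) (f : X ⊗ Y ⟶ Z) :
    g ≫ R.curry f = R.curry (g ▷ Y ≫ f) :=
  ((R.adj Y).homEquiv_naturality_left g f).symm

lemma curry_whiskerRight_ev {X Y Z : V} (f : X ⊗ Y ⟶ Z) :
    R.curry f ▷ Y ≫ R.ev Y Z = f :=
  ((R.adj Y).homEquiv_counit (g := R.curry f)).symm.trans
    (((R.adj Y).homEquiv X Z).symm_apply_apply f)

end RightClosed

namespace LeftClosed

variable (L : LeftClosed V)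

lemma comp_curry {X A A' B : V} (g : A' ⟶ A) (f : X ⊗ A ⟶ B) :
    g ≫ L.curry f = L.curry (X ◁ g ≫ f) :=
  ((L.adj X).homEquiv_naturality_left g f).symm

lemma whiskerLeft_curry_ev {X A B : V} (f : X ⊗ A ⟶ B) :
    X ◁ L.curry f ≫ L.ev X B = f :=
  ((L.adj X).homEquiv_counit (g := L.curry f)).symm.trans
    (((L.adj X).homEquiv A B).symm_apply_apply f)

end LeftClosed

lemma CartClosed.map_curry_ev {C : Type u} [Category.{v} C] [HasBinaryProducts C]
    (cc : CartClosed C) {W X B : C} (f : W ⨯ X ⟶ B) :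
    prod.map (cc.curry f) (𝟙 X) ≫ cc.ev X B = f :=
  ((cc.adj X).homEquiv_counit (g := cc.curry f)).symm.trans
    (((cc.adj X).homEquiv W B).symm_apply_apply f)

section Projections

variable (hI : IsTerminal (𝟙_ V))

lemma tensorHom_pi1 {X X' Y Y' : V} (f : X ⟶ X') (g : Y ⟶ Y') :
    (f ⊗ₘ g) ≫ pi1 hI X' Y' = pi1 hI X Y ≫ f := by
  have h : g ≫ hI.from Y' = hI.from Y := hI.hom_ext _ _
  simp only [pi1, MonoidalCategory.tensorHom_def, Category.assoc]
  rw [← whiskerLeft_comp_assoc, h, ← whisker_exchange_assoc]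
  simp

lemma tensorHom_pi2 {X X' Y Y' : V} (f : X ⟶ X') (g : Y ⟶ Y') :
    (f ⊗ₘ g) ≫ pi2 hI X' Y' = pi2 hI X Y ≫ g := by
  have h : f ≫ hI.from X' = hI.from X := hI.hom_ext _ _
  simp only [pi2, tensorHom_def', Category.assoc]
  rw [← comp_whiskerRight_assoc, h, whisker_exchange_assoc]
  simp

lemma whiskerRight_pi1 {X X' : V} (f : X ⟶ X') (Y : V) :
    f ▷ Y ≫ pi1 hI X' Y = pi1 hI X Y ≫ f := by
  simpa using tensorHom_pi1 hI f (𝟙 Y)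

lemma whiskerRight_pi2 {X X' : V} (f : X ⟶ X') (Y : V) :
    f ▷ Y ≫ pi2 hI X' Y = pi2 hI X Y := by
  simpa using tensorHom_pi2 hI f (𝟙 Y)

lemma whiskerLeft_pi1 (X : V) {Y Y' : V} (g : Y ⟶ Y') :
    X ◁ g ≫ pi1 hI X Y' = pi1 hI X Y := by
  simpa using tensorHom_pi1 hI (𝟙 X) g

lemma whiskerLeft_pi2 (X : V) {Y Y' : V} (g : Y ⟶ Y') :
    X ◁ g ≫ pi2 hI X Y' = pi2 hI X Y ≫ g := by
  simpa using tensorHom_pi2 hI (𝟙 X) g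

lemma pi1_unit (X : V) : pi1 hI X (𝟙_ V) = (ρ_ X).hom := by
  simp [pi1]

lemma pi2_unit (X : V) : pi2 hI (𝟙_ V) X = (λ_ X).hom := by
  simp [pi2]

lemma associator_hom_pi1 (X Y Z : V) :
    (α_ X Y Z).hom ≫ pi1 hI X (Y ⊗ Z) = pi1 hI (X ⊗ Y) Z ≫ pi1 hI X Y := by
  have h : pi1 hI Y Z ≫ hI.from Y = hI.from (Y ⊗ Z) := hI.hom_ext _ _
  rw [pi1.eq_def hI X (Y ⊗ Z), ← h]
  simp [pi1, -IsTerminal.comp_from]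

lemma associator_hom_pi2 (X Y Z : V) :
    (α_ X Y Z).hom ≫ pi2 hI X (Y ⊗ Z) ≫ pi2 hI Y Z = pi2 hI (X ⊗ Y) Z := by
  have h : pi2 hI X Y ≫ hI.from Y = hI.from (X ⊗ Y) := hI.hom_ext _ _
  rw [pi2.eq_def hI (X ⊗ Y), ← h]
  simp [pi2, -IsTerminal.comp_from]

lemma associator_hom_pi2_pi1 (X Y Z : V) :
    (α_ X Y Z).hom ≫ pi2 hI X (Y ⊗ Z) ≫ pi1 hI Y Z = pi1 hI (X ⊗ Y) Z ≫ pi2 hI X Y := by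
  rw [← whiskerLeft_pi2]
  simp [pi1, pi2]

variable [HasBinaryProducts V]

lemma whiskerRight_piMap {X X' : V} (f : X ⟶ X') (Y : V) :
    f ▷ Y ≫ piMap hI X' Y = piMap hI X Y ≫ prod.map f (𝟙 Y) := by
  ext <;> simp [piMap, prod.lift_fst, prod.lift_snd, whiskerRight_pi1, whiskerRight_pi2]

lemma whiskerLeft_piMap (X : V) {Y Y' : V} (g : Y ⟶ Y') :
    X ◁ g ≫ piMap hI X Y' = piMap hI X Y ≫ prod.map (𝟙 X) g := by
  ext <;> simp [piMap, prod.lift_fst, prod.lift_snd, whiskerLeft_pi1, whiskerLeft_pi2]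

/-- The morphisms `π` are compatible with the associators of `⊗` and `⨯`. -/
lemma piMap_associator (X Y Z : V) :
    (α_ X Y Z).hom ≫ X ◁ piMap hI Y Z ≫ piMap hI X (Y ⨯ Z) =
      piMap hI (X ⊗ Y) Z ≫ prod.map (piMap hI X Y) (𝟙 Z) ≫ (prod.associator X Y Z).hom := by
  rw [whiskerLeft_piMap]
  ext <;> simp [piMap, prod.lift_fst, prod.lift_snd, prod.lift_fst_assoc,
    associator_hom_pi1, associator_hom_pi2, associator_hom_pi2_pi1]

lemma cid_canr (R : RightClosed V) (cc : CartClosed V) (X : V) :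
    cc.cid X ≫ canr hI R cc X X = R.idr X := by
  rw [canr, R.comp_curry, RightClosed.idr, ← Category.assoc, whiskerRight_piMap, Category.assoc,
    CartClosed.cid, cc.map_curry_ev]
  simp [piMap, prod.lift_snd, pi2_unit]

lemma cid_canl (L : LeftClosed V) (cc : CartClosed V) (X : V) :
    cc.cid X ≫ canl hI L cc X X = L.idl X := by
  rw [canl, L.comp_curry, LeftClosed.idl, ← Category.assoc, whiskerLeft_piMap, Category.assoc,
    braid_natural_assoc, CartClosed.cid, cc.map_curry_ev]
  simp [piMap, prod.lift_fst, prod.lift_snd, pi1_unit]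

lemma piMap_ccomp_canr (R : RightClosed V) (cc : CartClosed V) (X Y Z : V) :
    (piMap hI (cc.ch Y Z) (cc.ch X Y) ≫ cc.ccomp X Y Z) ≫ canr hI R cc X Z =
      (canr hI R cc Y Z ⊗ₘ canr hI R cc X Y) ≫ R.compr X Y Z := by
  have hl : (piMap hI (cc.ch Y Z) (cc.ch X Y) ≫ cc.ccomp X Y Z) ▷ X ≫
      piMap hI (cc.ch X Z) X ≫ cc.ev X Z =
      (α_ _ _ _).hom ≫ cc.ch Y Z ◁ (piMap hI (cc.ch X Y) X ≫ cc.ev X Y) ≫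
        piMap hI (cc.ch Y Z) Y ≫ cc.ev Y Z := by
    have h := whiskerRight_piMap hI
      (piMap hI (cc.ch Y Z) (cc.ch X Y) ≫ cc.ccomp X Y Z) X
    have hm : prod.map (piMap hI (cc.ch Y Z) (cc.ch X Y) ≫ cc.ccomp X Y Z) (𝟙 X) =
        prod.map (piMap hI (cc.ch Y Z) (cc.ch X Y)) (𝟙 X) ≫ prod.map (cc.ccomp X Y Z) (𝟙 X) := by
      simp
    rw [reassoc_of% h, hm, Category.assoc, CartClosed.ccomp, cc.map_curry_ev,
      MonoidalCategory.whiskerLeft_comp, Category.assoc,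
      reassoc_of% (whiskerLeft_piMap hI (cc.ch Y Z) (cc.ev X Y)),
      reassoc_of% (piMap_associator hI (cc.ch Y Z) (cc.ch X Y) X)]
  have hr : (canr hI R cc Y Z ⊗ₘ canr hI R cc X Y) ▷ X ≫
      (α_ (R.hr Y Z) (R.hr X Y) X).hom ≫ (R.hr Y Z ◁ R.ev X Y) ≫ R.ev Y Z =
      (α_ _ _ _).hom ≫ cc.ch Y Z ◁ (piMap hI (cc.ch X Y) X ≫ cc.ev X Y) ≫
        piMap hI (cc.ch Y Z) Y ≫ cc.ev Y Z := by
    have h₁ := R.curry_whiskerRight_ev (piMap hI (cc.ch X Y) X ≫ cc.ev X Y)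
    have h₂ := R.curry_whiskerRight_ev (piMap hI (cc.ch Y Z) Y ≫ cc.ev Y Z)
    rw [← h₁, ← h₂]
    simp [canr, tensorHom_def', whisker_exchange_assoc]
  rw [canr, R.comp_curry, hl, RightClosed.compr, R.comp_curry, ← hr]

lemma lift_pi2_pi1_ccomp_canl (L : LeftClosed V) (cc : CartClosed V) (X Y Z : V) :
    (prod.lift (pi2 hI (cc.ch X Y) (cc.ch Y Z)) (pi1 hI (cc.ch X Y) (cc.ch Y Z))
        ≫ cc.ccomp X Y Z) ≫ canl hI L cc X Z =
      (canl hI L cc X Y ⊗ₘ canl hI L cc Y Z) ≫ L.compl X Y Z := by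
  set p := prod.lift (pi2 hI (cc.ch X Y) (cc.ch Y Z)) (pi1 hI (cc.ch X Y) (cc.ch Y Z)) with hp
  have hl : X ◁ (p ≫ cc.ccomp X Y Z) ≫
      piMap hI X (cc.ch X Z) ≫ (prod.braiding X (cc.ch X Z)).hom ≫ cc.ev X Z =
      (α_ _ _ _).inv ≫
        (piMap hI X (cc.ch X Y) ≫ (prod.braiding X (cc.ch X Y)).hom ≫ cc.ev X Y) ▷ cc.ch Y Z ≫
        piMap hI Y (cc.ch Y Z) ≫ (prod.braiding Y (cc.ch Y Z)).hom ≫ cc.ev Y Z := by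
    have h := whiskerLeft_piMap hI X (p ≫ cc.ccomp X Y Z)
    have hm : prod.map (p ≫ cc.ccomp X Y Z) (𝟙 X) =
        prod.map p (𝟙 X) ≫ prod.map (cc.ccomp X Y Z) (𝟙 X) := by
      simp
    have hc : (α_ X (cc.ch X Y) (cc.ch Y Z)).hom ≫ piMap hI X (cc.ch X Y ⊗ cc.ch Y Z) ≫
        (prod.braiding _ _).hom ≫ prod.map p (𝟙 X) ≫ (Limits.prod.associator _ _ _).hom =
        piMap hI (X ⊗ cc.ch X Y) (cc.ch Y Z) ≫ (prod.braiding _ _).hom ≫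
          prod.map (𝟙 _) (piMap hI X (cc.ch X Y) ≫ (prod.braiding _ _).hom) := by
      ext <;> simp [hp, piMap, prod.lift_fst, prod.lift_snd, prod.lift_fst_assoc, prod.lift_snd_assoc,
        associator_hom_pi1, associator_hom_pi2, associator_hom_pi2_pi1]
    rw [reassoc_of% h, braid_natural_assoc, hm, Category.assoc, CartClosed.ccomp, cc.map_curry_ev,
      reassoc_of% (whiskerRight_piMap hI (piMap hI X (cc.ch X Y) ≫
        (prod.braiding X (cc.ch X Y)).hom ≫ cc.ev X Y) (cc.ch Y Z)),
      braid_natural_assoc, Iso.eq_inv_comp, reassoc_of% hc, prod.map_map_assoc]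
    simp only [Category.assoc, Category.comp_id]
  have hr : X ◁ (canl hI L cc X Y ⊗ₘ canl hI L cc Y Z) ≫
      (α_ X (L.hl X Y) (L.hl Y Z)).inv ≫ (L.ev X Y ▷ L.hl Y Z) ≫ L.ev Y Z =
      (α_ _ _ _).inv ≫
        (piMap hI X (cc.ch X Y) ≫ (prod.braiding X (cc.ch X Y)).hom ≫ cc.ev X Y) ▷ cc.ch Y Z ≫
        piMap hI Y (cc.ch Y Z) ≫ (prod.braiding Y (cc.ch Y Z)).hom ≫ cc.ev Y Z := by
    have h₁ := L.whiskerLeft_curry_ev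
      (piMap hI X (cc.ch X Y) ≫ (prod.braiding X (cc.ch X Y)).hom ≫ cc.ev X Y)
    have h₂ := L.whiskerLeft_curry_ev
      (piMap hI Y (cc.ch Y Z) ≫ (prod.braiding Y (cc.ch Y Z)).hom ≫ cc.ev Y Z)
    rw [← h₁, ← h₂]
    simp [canl, MonoidalCategory.tensorHom_def, ← whisker_exchange_assoc]
  rw [canl, L.comp_curry, hl, LeftClosed.compl, L.comp_curry, ← hr]

end Projections

/-- Let `V` be a monoidal category with projections, cartesian closed,
with biclosed monoidal structure. The identity on objects together with the canonical
morphisms `can_r : Hom(X, Y) ⟶ Homᵣ(X, Y)` defines a `(V, ⊗)`-enriched functor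
`V_cart ⟶ V_r`, i.e. the morphisms `can_r` are compatible with the enriched identities
and the enriched compositions (the composition of `V_cart`, viewed as a
`(V, ⊗)`-category, being `π ≫ comp`). Dually, the morphisms
`can_l : Hom(X, Y) ⟶ Homₗ(X, Y)` define a `V̄`-enriched functor from `V_cart` (viewed
as a `V̄`-category via the structure morphisms with components `π₂`, `π₁`) to `V_l`. -/
theorem vcart_enriched_functor [HasFiniteProducts V] (hI : IsTerminal (𝟙_ V))
    (R : RightClosed V) (L : LeftClosed V) (cc : CartClosed V) :
    -- `can_r` is compatible with the enriched identities
    (∀ X : V, cc.cid X ≫ canr hI R cc X X = R.idr X) ∧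
    -- `can_r` is compatible with the enriched compositions
    (∀ X Y Z : V,
      (piMap hI (cc.ch Y Z) (cc.ch X Y) ≫ cc.ccomp X Y Z) ≫ canr hI R cc X Z
        = (canr hI R cc Y Z ⊗ₘ canr hI R cc X Y) ≫ R.compr X Y Z) ∧
    -- `can_l` is compatible with the enriched identities
    (∀ X : V, cc.cid X ≫ canl hI L cc X X = L.idl X) ∧
    -- `can_l` is compatible with the (anti) enriched compositions
    (∀ X Y Z : V,
      (prod.lift (pi2 hI (cc.ch X Y) (cc.ch Y Z)) (pi1 hI (cc.ch X Y) (cc.ch Y Z))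
          ≫ cc.ccomp X Y Z) ≫ canl hI L cc X Z
        = (canl hI L cc X Y ⊗ₘ canl hI L cc Y Z) ≫ L.compl X Y Z) := by
  exact ⟨cid_canr hI R cc, piMap_ccomp_canr hI R cc, cid_canl hI L cc,
    lift_pi2_pi1_ccomp_canl hI L cc⟩

end PaperComma

end
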